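/- Let M, a be reals with 0 ≤ a < M, let k, α, β be real constants with cos k ≠ 0, and define Θ = β + α( t − a cosθ sin k / cos k ) on U. Let u : U → ℝ be a positive C² function depending only on (r,θ) with ∂_r u / u = (M − r − α(r²+a²))/Δ and ∂_θ u / u = −cotθ. Then the 2-form F₁₀B = (u/√Δ)[ −a cos k sinθ coshΘ dt∧dr + Δ sin k sinhΘ dt∧dθ + Δ cos k sinθ sinhΘ dt∧dφ − ρ² sin k coshΘ dr∧dθ − (r²+a²) cos k sinθ coshΘ dr∧dφ + aΔ sin k sin²θ sinhΘ dθ∧dφ ] is closed and force-free on U (F_{μν} j^ν = 0 for its current density j), and F₁₀B² := g^{μα}g^{νβ}F_{αβ}F_{μν} = 2u², so F₁₀B is magnetically dominated. -/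

import Mathlib

noncomputable section

/-- Partial derivative of `f` in the coordinate direction `μ`,
coordinates `(x 0, x 1, x 2, x 3) = (t, r, θ, φ)`. -/
def pd (μ : Fin 4) (f : (Fin 4 → ℝ) → ℝ) (x : Fin 4 → ℝ) : ℝ :=
  fderiv ℝ f x (Pi.single μ 1)

/-- ρ² = r² + a² cos²θ. -/
def rho2 (a : ℝ) (x : Fin 4 → ℝ) : ℝ := (x 1) ^ 2 + a ^ 2 * Real.cos (x 2) ^ 2

/-- Δ = r² − 2Mr + a². -/
def Del (M a : ℝ) (x : Fin 4 → ℝ) : ℝ := (x 1) ^ 2 - 2 * M * (x 1) + a ^ 2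

/-- Σ² = (r²+a²)² − Δ a² sin²θ. -/
def Sig2 (M a : ℝ) (x : Fin 4 → ℝ) : ℝ :=
  ((x 1) ^ 2 + a ^ 2) ^ 2 - Del M a x * a ^ 2 * Real.sin (x 2) ^ 2

/-- The Kerr metric in Boyer–Lindquist coordinates `(t, r, θ, φ)`. -/
def kerr (M a : ℝ) (x : Fin 4 → ℝ) : Matrix (Fin 4) (Fin 4) ℝ :=
  Matrix.of fun μ ν =>
    if μ = 0 ∧ ν = 0 then -1 + 2 * M * (x 1) / rho2 a x
    else if (μ = 0 ∧ ν = 3) ∨ (μ = 3 ∧ ν = 0) then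
      -(2 * M * (x 1) * a * Real.sin (x 2) ^ 2) / rho2 a x
    else if μ = 1 ∧ ν = 1 then rho2 a x / Del M a x
    else if μ = 2 ∧ ν = 2 then rho2 a x
    else if μ = 3 ∧ ν = 3 then Sig2 M a x * Real.sin (x 2) ^ 2 / rho2 a x
    else 0

/-- The exterior Kerr domain U = {r > r₊, 0 < θ < π}. -/
def KerrExt (M a : ℝ) : Set (Fin 4 → ℝ) :=
  {x | M + Real.sqrt (M ^ 2 - a ^ 2) < x 1 ∧ 0 < x 2 ∧ x 2 < Real.pi}

/-- `wedge μ ν f` is the antisymmetric matrix of the 2-form `f dx^μ ∧ dx^ν`. -/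
def wedge (μ ν : Fin 4) (f : ℝ) : Matrix (Fin 4) (Fin 4) ℝ :=
  Matrix.of fun i j => if i = μ ∧ j = ν then f else if i = ν ∧ j = μ then -f else 0

/-- A 2-form `F` is closed on `S`: ∂_μ F_{νλ} + ∂_ν F_{λμ} + ∂_λ F_{μν} = 0. -/
def Closed2Form (F : (Fin 4 → ℝ) → Matrix (Fin 4) (Fin 4) ℝ) (S : Set (Fin 4 → ℝ)) : Prop :=
  ∀ x ∈ S, ∀ μ ν lam : Fin 4,
    pd μ (fun y => F y ν lam) x + pd ν (fun y => F y lam μ) x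
      + pd lam (fun y => F y μ ν) x = 0

/-- Current density j^μ = (ρ²sinθ)⁻¹ ∂_ν (ρ²sinθ g^{μα} g^{νβ} F_{αβ}). -/
def current (M a : ℝ) (F : (Fin 4 → ℝ) → Matrix (Fin 4) (Fin 4) ℝ)
    (x : Fin 4 → ℝ) (μ : Fin 4) : ℝ :=
  (rho2 a x * Real.sin (x 2))⁻¹ *
    ∑ ν : Fin 4, pd ν (fun y => rho2 a y * Real.sin (y 2) *
      ∑ i : Fin 4, ∑ j : Fin 4, (kerr M a y)⁻¹ μ i * (kerr M a y)⁻¹ ν j * F y i j) x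

/-- `F` is force-free on `S`: F_{μν} j^ν = 0 for the current density `j` of `F`. -/
def ForceFree (M a : ℝ) (F : (Fin 4 → ℝ) → Matrix (Fin 4) (Fin 4) ℝ)
    (S : Set (Fin 4 → ℝ)) : Prop :=
  ∀ x ∈ S, ∀ μ : Fin 4, ∑ ν : Fin 4, F x μ ν * current M a F x ν = 0

/-- The invariant F² = g^{μα} g^{νβ} F_{αβ} F_{μν}. -/
def Fsq (M a : ℝ) (F : (Fin 4 → ℝ) → Matrix (Fin 4) (Fin 4) ℝ) (x : Fin 4 → ℝ) : ℝ :=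
  ∑ μ : Fin 4, ∑ ν : Fin 4, ∑ i : Fin 4, ∑ j : Fin 4,
    (kerr M a x)⁻¹ μ i * (kerr M a x)⁻¹ ν j * F x i j * F x μ ν

/-- Θ = β + α( t − a cosθ sin k / cos k ). -/
def ThB (a k α β : ℝ) (x : Fin 4 → ℝ) : ℝ :=
  β + α * (x 0 - a * Real.cos (x 2) * Real.sin k / Real.cos k)

/-- The 2-form F₁₀B. -/
def F10B (M a k α β : ℝ) (u : ℝ × ℝ → ℝ) (x : Fin 4 → ℝ) : Matrix (Fin 4) (Fin 4) ℝ :=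
  let TH := ThB a k α β
  wedge 0 1 (u (x 1, x 2) / Real.sqrt (Del M a x) *
      (-(a * Real.cos k * Real.sin (x 2) * Real.cosh (TH x))))
    + wedge 0 2 (u (x 1, x 2) / Real.sqrt (Del M a x) *
      (Del M a x * Real.sin k * Real.sinh (TH x)))
    + wedge 0 3 (u (x 1, x 2) / Real.sqrt (Del M a x) *
      (Del M a x * Real.cos k * Real.sin (x 2) * Real.sinh (TH x)))
    + wedge 1 2 (u (x 1, x 2) / Real.sqrt (Del M a x) *
      (-(rho2 a x * Real.sin k * Real.cosh (TH x))))
    + wedge 1 3 (u (x 1, x 2) / Real.sqrt (Del M a x) *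
      (-(((x 1) ^ 2 + a ^ 2) * Real.cos k * Real.sin (x 2) * Real.cosh (TH x))))
    + wedge 2 3 (u (x 1, x 2) / Real.sqrt (Del M a x) *
      (a * Del M a x * Real.sin k * Real.sin (x 2) ^ 2 * Real.sinh (TH x)))

/-- `f` is differentiable at `x` with partial derivatives `d`. -/
def HasP (f : (Fin 4 → ℝ) → ℝ) (x : Fin 4 → ℝ) (d : Fin 4 → ℝ) : Prop :=
  ∃ f' : (Fin 4 → ℝ) →L[ℝ] ℝ, HasFDerivAt f f' x ∧ ∀ μ, f' (Pi.single μ 1) = d μ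

lemma HasP.pd_eq {f x d} (h : HasP f x d) (μ : Fin 4) : pd μ f x = d μ := by
  obtain ⟨f', h1, h2⟩ := h
  rw [pd, h1.fderiv, h2]

lemma HasP.congr_val {f x d d'} (h : HasP f x d) (e : ∀ μ, d μ = d' μ) : HasP f x d' := by
  obtain ⟨f', h1, h2⟩ := h
  exact ⟨f', h1, fun μ => (h2 μ).trans (e μ)⟩

lemma HasP.mul {f g x d e} (h : HasP f x d) (h' : HasP g x e) :
    HasP (fun y => f y * g y) x (fun μ => f x * e μ + g x * d μ) := by
  obtain ⟨f', h1, h2⟩ := h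
  obtain ⟨g', h3, h4⟩ := h'
  exact ⟨_, h1.mul h3, fun μ => by simp [h2, h4]⟩

lemma HasP.neg {f x d} (h : HasP f x d) : HasP (fun y => - f y) x (fun μ => - d μ) := by
  obtain ⟨f', h1, h2⟩ := h
  exact ⟨_, h1.neg, fun μ => by simp [h2]⟩

lemma HasP.zero {x} : HasP (fun _ => 0) x (fun _ => 0) :=
  ⟨0, hasFDerivAt_const _ _, fun μ => by simp⟩

lemma HasP.const_mul {f x d} (c : ℝ) (h : HasP f x d) :
    HasP (fun y => c * f y) x (fun μ => c * d μ) := by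
  obtain ⟨f', h1, h2⟩ := h
  exact ⟨_, h1.const_mul c, fun μ => by simp [h2]⟩

lemma HasP.comp {f x d} {φ : ℝ → ℝ} {φ' : ℝ} (hφ : HasDerivAt φ φ' (f x)) (h : HasP f x d) :
    HasP (fun y => φ (f y)) x (fun μ => φ' * d μ) := by
  obtain ⟨f', h1, h2⟩ := h
  exact ⟨_, hφ.comp_hasFDerivAt x h1, fun μ => by simp [h2]⟩

lemma HasP.coord (i : Fin 4) (x : Fin 4 → ℝ) :
    HasP (fun y => y i) x (fun μ => if μ = i then 1 else 0) :=
  ⟨ContinuousLinearMap.proj i, hasFDerivAt_apply i x, fun μ => by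
    simp [Pi.single_apply, eq_comm]⟩

lemma HasP.congr_ev {f g x d} (h : HasP f x d) (e : g =ᶠ[nhds x] f) : HasP g x d := by
  obtain ⟨f', h1, h2⟩ := h
  exact ⟨f', h1.congr_of_eventuallyEq e, h2⟩

lemma kerrExt_isOpen (M a : ℝ) : IsOpen (KerrExt M a) := by
  refine IsOpen.inter ?_ (IsOpen.inter ?_ ?_)
  · exact isOpen_lt continuous_const (continuous_apply 1)
  · exact isOpen_lt continuous_const (continuous_apply 2)
  · exact isOpen_lt (continuous_apply 2) continuous_const

lemma kerrExt_pos {M a : ℝ} (ha : 0 ≤ a) (haM : a < M) {x} (hx : x ∈ KerrExt M a) :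
    0 < Del M a x ∧ 0 < rho2 a x ∧ 0 < Real.sin (x 2) := by
  obtain ⟨h1, h2, h3⟩ := hx
  have hs : 0 ≤ M ^ 2 - a ^ 2 := by nlinarith
  have hq := Real.sq_sqrt hs
  have hq0 := Real.sqrt_nonneg (M ^ 2 - a ^ 2)
  refine ⟨?_, ?_, Real.sin_pos_of_pos_of_lt_pi h2 h3⟩
  · unfold Del; nlinarith
  · unfold rho2
    have : 0 < x 1 := by linarith
    positivity

/-- Explicit inverse metric. -/
def kinv (M a : ℝ) (x : Fin 4 → ℝ) : Matrix (Fin 4) (Fin 4) ℝ :=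
  !![-(Sig2 M a x) / (rho2 a x * Del M a x), 0, 0, -(2 * M * x 1 * a) / (rho2 a x * Del M a x);
     0, Del M a x / rho2 a x, 0, 0;
     0, 0, 1 / rho2 a x, 0;
     -(2 * M * x 1 * a) / (rho2 a x * Del M a x), 0, 0,
       (Del M a x - a ^ 2 * Real.sin (x 2) ^ 2)
         / (rho2 a x * Del M a x * Real.sin (x 2) ^ 2)]

lemma kerr_inv {M a : ℝ} (ha : 0 ≤ a) (haM : a < M) {x} (hx : x ∈ KerrExt M a) :
    (kerr M a x)⁻¹ = kinv M a x := by
  obtain ⟨h1, h2, h3⟩ := kerrExt_pos ha haM hx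
  apply Matrix.inv_eq_right_inv
  have e1 : rho2 a x = x 1 ^ 2 + a ^ 2 * (1 - Real.sin (x 2) ^ 2) := by
    rw [rho2, Real.cos_sq']
  have h1' := h1.ne'
  have h2' := h2.ne'
  have h3' := h3.ne'
  have e2 : 2 * M * x 1 = x 1 ^ 2 + a ^ 2 - Del M a x := by rw [Del]; ring
  ext i j
  fin_cases i <;> fin_cases j <;>
    simp [kerr, kinv, Matrix.mul_apply, Fin.sum_univ_four, Sig2, e2] <;>
    field_simp <;> (try rw [e1]) <;> ring

/-- Components of F10B. -/
def Fm (M a k α β : ℝ) (w : (Fin 4 → ℝ) → ℝ) (x : Fin 4 → ℝ) : Matrix (Fin 4) (Fin 4) ℝ :=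
  let C := Real.cosh (ThB a k α β x)
  let S := Real.sinh (ThB a k α β x)
  let s := Real.sin (x 2)
  let f01 := w x * (-(a * Real.cos k * s * C))
  let f02 := w x * (Del M a x * Real.sin k * S)
  let f03 := w x * (Del M a x * Real.cos k * s * S)
  let f12 := w x * (-(rho2 a x * Real.sin k * C))
  let f13 := w x * (-((x 1 ^ 2 + a ^ 2) * Real.cos k * s * C))
  let f23 := w x * (a * Del M a x * Real.sin k * s ^ 2 * S)
  !![0, f01, f02, f03; -f01, 0, f12, f13; -f02, -f12, 0, f23; -f03, -f13, -f23, 0]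

/-- Components of the contravariant density. -/
def Hm (M a k α β : ℝ) (w : (Fin 4 → ℝ) → ℝ) (x : Fin 4 → ℝ) : Matrix (Fin 4) (Fin 4) ℝ :=
  let C := Real.cosh (ThB a k α β x)
  let S := Real.sinh (ThB a k α β x)
  let s := Real.sin (x 2)
  let f01 := w x * (a * Real.cos k * s ^ 2 * C * Del M a x)
  let f02 := w x * (-(s * Real.sin k * S * (x 1 ^ 2 + a ^ 2)))
  let f03 := w x * (-(rho2 a x * Real.cos k * S))
  let f12 := w x * (-(s * Real.sin k * C * Del M a x))
  let f13 := w x * (-(Real.cos k * C * Del M a x))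
  let f23 := w x * (s * a * Real.sin k * S)
  !![0, f01, f02, f03; -f01, 0, f12, f13; -f02, -f12, 0, f23; -f03, -f13, -f23, 0]

lemma F10B_eq (M a k α β : ℝ) (u : ℝ × ℝ → ℝ) (x : Fin 4 → ℝ) :
    F10B M a k α β u x = Fm M a k α β (fun y => u (y 1, y 2) / Real.sqrt (Del M a y)) x := by
  ext i j
  fin_cases i <;> fin_cases j <;> simp [F10B, Fm, wedge]

lemma raise {M a : ℝ} (ha : 0 ≤ a) (haM : a < M) (k α β : ℝ) (w : (Fin 4 → ℝ) → ℝ)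
    {x} (hx : x ∈ KerrExt M a) (μ ν : Fin 4) :
    rho2 a x * Real.sin (x 2) * ∑ i : Fin 4, ∑ j : Fin 4,
      (kerr M a x)⁻¹ μ i * (kerr M a x)⁻¹ ν j * Fm M a k α β w x i j
      = Hm M a k α β w x μ ν := by
  obtain ⟨h1, h2, h3⟩ := kerrExt_pos ha haM hx
  rw [kerr_inv ha haM hx]
  have e1 : rho2 a x = x 1 ^ 2 + a ^ 2 * (1 - Real.sin (x 2) ^ 2) := by
    rw [rho2, Real.cos_sq']
  have h1' := h1.ne'
  have h2' := h2.ne'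
  have h3' := h3.ne'
  have e2 : 2 * M * x 1 = x 1 ^ 2 + a ^ 2 - Del M a x := by rw [Del]; ring
  fin_cases μ <;> fin_cases ν <;>
    simp [kinv, Fm, Hm, Fin.sum_univ_four, Sig2, e2] <;>
    field_simp <;> (try rw [e1]) <;> first | ring1 | (right; ring1)

lemma fsq_eq {M a : ℝ} (ha : 0 ≤ a) (haM : a < M) (k α β : ℝ) (w : (Fin 4 → ℝ) → ℝ)
    {x} (hx : x ∈ KerrExt M a) (F) (hF : F x = Fm M a k α β w x) :
    Fsq M a F x = 2 * (w x ^ 2 * Del M a x) := by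
  obtain ⟨h1, h2, h3⟩ := kerrExt_pos ha haM hx
  have h2' := h2.ne'
  have h3' := h3.ne'
  have key : rho2 a x * Real.sin (x 2) * Fsq M a F x
      = ∑ μ : Fin 4, ∑ ν : Fin 4, Hm M a k α β w x μ ν * Fm M a k α β w x μ ν := by
    simp only [← raise ha haM k α β w hx, Fsq, hF, Finset.mul_sum, Finset.sum_mul]
    refine Finset.sum_congr rfl fun _ _ => Finset.sum_congr rfl fun _ _ =>
      Finset.sum_congr rfl fun _ _ => Finset.sum_congr rfl fun _ _ => by ring
  have e1 : rho2 a x = x 1 ^ 2 + a ^ 2 * (1 - Real.sin (x 2) ^ 2) := by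
    rw [rho2, Real.cos_sq']
  have hC : Real.cosh (ThB a k α β x) ^ 2 = 1 + Real.sinh (ThB a k α β x) ^ 2 := by
    rw [Real.cosh_sq]; ring
  have hK : Real.cos k ^ 2 = 1 - Real.sin k ^ 2 := Real.cos_sq' k
  have : rho2 a x * Real.sin (x 2) * Fsq M a F x
      = rho2 a x * Real.sin (x 2) * (2 * (w x ^ 2 * Del M a x)) := by
    rw [key]
    simp [Fm, Hm, Fin.sum_univ_four]
    rw [e1]
    ring_nf
    simp only [hC, hK]
    ring
  exact mul_left_cancel₀ (mul_ne_zero h2' h3') this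

lemma HasP.const (c : ℝ) {x} : HasP (fun _ => c) x (fun _ => 0) :=
  ⟨0, hasFDerivAt_const _ _, fun μ => by simp⟩

lemma HasP.add {f g x d e} (h : HasP f x d) (h' : HasP g x e) :
    HasP (fun y => f y + g y) x (fun μ => d μ + e μ) := by
  obtain ⟨f', h1, h2⟩ := h
  obtain ⟨g', h3, h4⟩ := h'
  exact ⟨_, h1.add h3, fun μ => by simp [h2, h4]⟩

lemma hasP_sq {f x d} (h : HasP f x d) :
    HasP (fun y => f y ^ 2) x (fun μ => 2 * f x * d μ) := by
  have := h.comp (φ := fun z => z ^ 2) (φ' := 2 * f x) (by simpa using hasDerivAt_pow 2 (f x))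
  exact this

lemma hasP_sin (x : Fin 4 → ℝ) :
    HasP (fun y => Real.sin (y 2)) x ![0, 0, Real.cos (x 2), 0] := by
  refine ((HasP.coord 2 x).comp (Real.hasDerivAt_sin (x 2))).congr_val fun μ => ?_
  fin_cases μ <;> simp

lemma hasP_r2 (a : ℝ) (x : Fin 4 → ℝ) :
    HasP (fun y => y 1 ^ 2 + a ^ 2) x ![0, 2 * x 1, 0, 0] := by
  refine ((hasP_sq (HasP.coord 1 x)).add (HasP.const (a ^ 2))).congr_val fun μ => ?_
  fin_cases μ <;> simp

lemma hasP_del (M a : ℝ) (x : Fin 4 → ℝ) :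
    HasP (Del M a) x ![0, 2 * x 1 - 2 * M, 0, 0] := by
  have h := (((hasP_sq (HasP.coord 1 x)).add
    ((HasP.coord 1 x).const_mul (2 * M)).neg).add (HasP.const (a ^ 2)))
  have e : Del M a = fun y => y 1 ^ 2 + -(2 * M * y 1) + a ^ 2 := by
    funext y; rw [Del]; ring
  rw [e]
  refine h.congr_val fun μ => ?_
  fin_cases μ <;> simp
  ring

lemma hasP_rho2 (a : ℝ) (x : Fin 4 → ℝ) :
    HasP (rho2 a) x ![0, 2 * x 1, -(2 * a ^ 2 * Real.cos (x 2) * Real.sin (x 2)), 0] := by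
  have h := ((hasP_sq (HasP.coord 1 x)).add
    ((hasP_sq ((HasP.coord 2 x).comp (Real.hasDerivAt_cos (x 2)))).const_mul (a ^ 2)))
  refine HasP.congr_val (f := rho2 a) h fun μ => ?_
  fin_cases μ <;> simp
  ring

lemma hasP_th (a k α β : ℝ) (x : Fin 4 → ℝ) :
    HasP (ThB a k α β) x
      ![α, 0, α * a * Real.sin (x 2) * Real.sin k / Real.cos k, 0] := by
  have h := (HasP.const β).add (((HasP.coord 0 x).add
    (((HasP.coord 2 x).comp (Real.hasDerivAt_cos (x 2))).const_mul
      (-(a * Real.sin k / Real.cos k)))).const_mul α)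
  have e : ThB a k α β = fun y => β + α * (y 0 + -(a * Real.sin k / Real.cos k)
      * Real.cos (y 2)) := by
    funext y; rw [ThB]; ring
  rw [e]
  refine h.congr_val fun μ => ?_
  fin_cases μ <;> simp
  ring

lemma hasP_cosh (a k α β : ℝ) (x : Fin 4 → ℝ) :
    HasP (fun y => Real.cosh (ThB a k α β y)) x
      ![Real.sinh (ThB a k α β x) * α, 0, Real.sinh (ThB a k α β x) *
        (α * a * Real.sin (x 2) * Real.sin k / Real.cos k), 0] := by
  refine ((hasP_th a k α β x).comp (Real.hasDerivAt_cosh _)).congr_val fun μ => ?_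
  fin_cases μ <;> simp

lemma hasP_sinh (a k α β : ℝ) (x : Fin 4 → ℝ) :
    HasP (fun y => Real.sinh (ThB a k α β y)) x
      ![Real.cosh (ThB a k α β x) * α, 0, Real.cosh (ThB a k α β x) *
        (α * a * Real.sin (x 2) * Real.sin k / Real.cos k), 0] := by
  refine ((hasP_th a k α β x).comp (Real.hasDerivAt_sinh _)).congr_val fun μ => ?_
  fin_cases μ <;> simp

lemma hasP_w {M a α : ℝ} (ha : 0 ≤ a) (haM : a < M) (u : ℝ × ℝ → ℝ) {x}
    (hx : x ∈ KerrExt M a) (hd : DifferentiableAt ℝ u (x 1, x 2))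
    (hur : fderiv ℝ u (x 1, x 2) (1, 0)
        = u (x 1, x 2) * ((M - x 1 - α * (x 1 ^ 2 + a ^ 2)) / Del M a x))
    (hut : fderiv ℝ u (x 1, x 2) (0, 1)
        = u (x 1, x 2) * (-(Real.cos (x 2) / Real.sin (x 2)))) :
    HasP (fun y => u (y 1, y 2) / Real.sqrt (Del M a y)) x
      ![0, u (x 1, x 2) / Real.sqrt (Del M a x) *
          ((2 * (M - x 1) - α * (x 1 ^ 2 + a ^ 2)) / Del M a x),
        u (x 1, x 2) / Real.sqrt (Del M a x) * (-(Real.cos (x 2) / Real.sin (x 2))), 0] := by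
  obtain ⟨h1, h2, h3⟩ := kerrExt_pos ha haM hx
  have hU : HasP (fun y => u (y 1, y 2)) x ![0, fderiv ℝ u (x 1, x 2) (1, 0),
      fderiv ℝ u (x 1, x 2) (0, 1), 0] := by
    refine ⟨(fderiv ℝ u (x 1, x 2)).comp ((ContinuousLinearMap.proj (R := ℝ) 1).prod
      (ContinuousLinearMap.proj (R := ℝ) 2)),
      HasFDerivAt.comp (g := u) (f := fun y : Fin 4 → ℝ => (y 1, y 2)) x hd.hasFDerivAt
        ((hasFDerivAt_apply 1 x).prodMk (hasFDerivAt_apply 2 x)), fun μ => ?_⟩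
    fin_cases μ <;> simp <;> exact map_zero (fderiv ℝ u (x 1, x 2))
  have hq : 0 < Real.sqrt (Del M a x) := Real.sqrt_pos.2 h1
  have hI := (hasP_del M a x).comp ((Real.hasDerivAt_sqrt h1.ne').inv hq.ne')
  simp only [div_eq_mul_inv (u _)]
  refine (hU.mul hI).congr_val fun μ => ?_
  have hsq : Real.sqrt (Del M a x) ^ 2 = Del M a x := Real.sq_sqrt h1.le
  have h1' := h1.ne'
  have h3' := h3.ne'
  have hq' := hq.ne'
  fin_cases μ <;> simp [hur, hut, hsq]
  · field_simp
    ring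
  · ring

lemma antisym_hasP {f01 f02 f03 f12 f13 f23 : (Fin 4 → ℝ) → ℝ} {x}
    {d01 d02 d03 d12 d13 d23 : Fin 4 → ℝ}
    (h01 : HasP f01 x d01) (h02 : HasP f02 x d02) (h03 : HasP f03 x d03)
    (h12 : HasP f12 x d12) (h13 : HasP f13 x d13) (h23 : HasP f23 x d23) (i j : Fin 4) :
    HasP (fun y => !![0, f01 y, f02 y, f03 y; -f01 y, 0, f12 y, f13 y;
      -f02 y, -f12 y, 0, f23 y; -f03 y, -f13 y, -f23 y, 0] i j) x
      (fun μ => !![0, d01 μ, d02 μ, d03 μ; -d01 μ, 0, d12 μ, d13 μ;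
      -d02 μ, -d12 μ, 0, d23 μ; -d03 μ, -d13 μ, -d23 μ, 0] i j) := by
  fin_cases i <;> fin_cases j
  · exact HasP.zero
  · exact h01
  · exact h02
  · exact h03
  · exact h01.neg
  · exact HasP.zero
  · exact h12
  · exact h13
  · exact h02.neg
  · exact h12.neg
  · exact HasP.zero
  · exact h23
  · exact h03.neg
  · exact h13.neg
  · exact h23.neg
  · exact HasP.zero

lemma closed_at {M a k α β : ℝ} (ha : 0 ≤ a) (haM : a < M) (hk : Real.cos k ≠ 0)
    (w : (Fin 4 → ℝ) → ℝ) {x} (hx : x ∈ KerrExt M a)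
    (hw : HasP w x ![0, w x * ((2 * (M - x 1) - α * (x 1 ^ 2 + a ^ 2)) / Del M a x),
        w x * (-(Real.cos (x 2) / Real.sin (x 2))), 0]) (μ ν lam : Fin 4) :
    pd μ (fun y => Fm M a k α β w y ν lam) x + pd ν (fun y => Fm M a k α β w y lam μ) x
      + pd lam (fun y => Fm M a k α β w y μ ν) x = 0 := by
  obtain ⟨h1, h2, h3⟩ := kerrExt_pos ha haM hx
  have h1' := h1.ne'
  have h3' := h3.ne'
  have hs := hasP_sin x
  have hD := hasP_del M a x
  have hC := hasP_cosh a k α β x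
  have hS := hasP_sinh a k α β x
  have hR := hasP_rho2 a x
  have hr := hasP_r2 a x
  have e1 : rho2 a x = x 1 ^ 2 + a ^ 2 * (1 - Real.sin (x 2) ^ 2) := by
    rw [rho2, Real.cos_sq']
  have H := antisym_hasP
    (hw.mul (((HasP.const (a * Real.cos k)).mul hs).mul hC).neg)
    (hw.mul ((hD.mul (HasP.const (Real.sin k))).mul hS))
    (hw.mul (((hD.mul (HasP.const (Real.cos k))).mul hs).mul hS))
    (hw.mul ((hR.mul (HasP.const (Real.sin k))).mul hC).neg)
    (hw.mul (((hr.mul (HasP.const (Real.cos k))).mul hs).mul hC).neg)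
    (hw.mul (((((HasP.const a).mul hD).mul (HasP.const (Real.sin k))).mul (hasP_sq hs)).mul hS))
  have H' : ∀ i j μ, pd μ (fun y => Fm M a k α β w y i j) x = _ :=
    fun i j μ => (H i j).pd_eq μ
  rw [H', H', H']
  clear H H' hs hD hC hS hR hr hw
  fin_cases μ <;> fin_cases ν <;> fin_cases lam <;> simp <;>
    field_simp <;> (try rw [e1]) <;> ring

lemma div_at {M a k α β : ℝ} (ha : 0 ≤ a) (haM : a < M) (hk : Real.cos k ≠ 0)
    (w : (Fin 4 → ℝ) → ℝ) {x} (hx : x ∈ KerrExt M a)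
    (hw : HasP w x ![0, w x * ((2 * (M - x 1) - α * (x 1 ^ 2 + a ^ 2)) / Del M a x),
        w x * (-(Real.cos (x 2) / Real.sin (x 2))), 0]) (μ : Fin 4) :
    ∑ ν : Fin 4, pd ν (fun y => Hm M a k α β w y μ ν) x =
      -(α * a * Real.sin (x 2) ^ 2 * w x / Real.cos k) *
      ![Real.cosh (ThB a k α β x) * (x 1 ^ 2 + a ^ 2), Real.sinh (ThB a k α β x) * Del M a x, 0,
        a * Real.cosh (ThB a k α β x)] μ := by
  obtain ⟨h1, h2, h3⟩ := kerrExt_pos ha haM hx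
  have h1' := h1.ne'
  have h3' := h3.ne'
  have hs := hasP_sin x
  have hD := hasP_del M a x
  have hC := hasP_cosh a k α β x
  have hS := hasP_sinh a k α β x
  have hR := hasP_rho2 a x
  have hr := hasP_r2 a x
  have e1 : rho2 a x = x 1 ^ 2 + a ^ 2 * (1 - Real.sin (x 2) ^ 2) := by
    rw [rho2, Real.cos_sq']
  have hL : Real.sin k ^ 2 = 1 - Real.cos k ^ 2 := Real.sin_sq k
  have H := antisym_hasP
    (hw.mul ((((HasP.const (a * Real.cos k)).mul (hasP_sq hs)).mul hC).mul hD))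
    (hw.mul (((hs.mul (HasP.const (Real.sin k))).mul hS).mul hr).neg)
    (hw.mul ((hR.mul (HasP.const (Real.cos k))).mul hS).neg)
    (hw.mul (((hs.mul (HasP.const (Real.sin k))).mul hC).mul hD).neg)
    (hw.mul (((HasP.const (Real.cos k)).mul hC).mul hD).neg)
    (hw.mul (((hs.mul (HasP.const a)).mul (HasP.const (Real.sin k))).mul hS))
  have H' : ∀ i j μ, pd μ (fun y => Hm M a k α β w y i j) x = _ :=
    fun i j μ => (H i j).pd_eq μ
  rw [Fin.sum_univ_four, H', H', H', H']
  clear H H' hs hD hC hS hR hr hw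
  fin_cases μ <;> simp <;>
    field_simp <;> (try rw [e1]) <;> ring_nf <;> (try simp only [hL]) <;> ring

/-- F₁₀B is closed and force-free on U, and F₁₀B² = 2u², so F₁₀B is
magnetically dominated. -/
theorem kerr_F10B_forcefree (M a k α β : ℝ) (ha : 0 ≤ a) (haM : a < M)
    (hk : Real.cos k ≠ 0)
    (u : ℝ × ℝ → ℝ)
    (hu : ContDiffOn ℝ 2 u
      (Set.Ioi (M + Real.sqrt (M ^ 2 - a ^ 2)) ×ˢ Set.Ioo 0 Real.pi))
    (hupos : ∀ p ∈ Set.Ioi (M + Real.sqrt (M ^ 2 - a ^ 2)) ×ˢ Set.Ioo 0 Real.pi,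
      0 < u p)
    (hur : ∀ p ∈ Set.Ioi (M + Real.sqrt (M ^ 2 - a ^ 2)) ×ˢ Set.Ioo 0 Real.pi,
      fderiv ℝ u p (1, 0)
        = u p * ((M - p.1 - α * (p.1 ^ 2 + a ^ 2)) / (p.1 ^ 2 - 2 * M * p.1 + a ^ 2)))
    (hut : ∀ p ∈ Set.Ioi (M + Real.sqrt (M ^ 2 - a ^ 2)) ×ˢ Set.Ioo 0 Real.pi,
      fderiv ℝ u p (0, 1) = u p * (-(Real.cos p.2 / Real.sin p.2))) :
    Closed2Form (F10B M a k α β u) (KerrExt M a) ∧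
    ForceFree M a (F10B M a k α β u) (KerrExt M a) ∧
    ∀ x ∈ KerrExt M a, Fsq M a (F10B M a k α β u) x = 2 * u (x 1, x 2) ^ 2 := by
  have hmem : ∀ x ∈ KerrExt M a, ((x 1, x 2) : ℝ × ℝ) ∈
      Set.Ioi (M + Real.sqrt (M ^ 2 - a ^ 2)) ×ˢ Set.Ioo 0 Real.pi :=
    fun x hx => ⟨hx.1, hx.2⟩
  have hopen : IsOpen (Set.Ioi (M + Real.sqrt (M ^ 2 - a ^ 2)) ×ˢ Set.Ioo 0 Real.pi) :=
    isOpen_Ioi.prod isOpen_Ioo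
  have hw : ∀ x ∈ KerrExt M a, HasP (fun y => u (y 1, y 2) / Real.sqrt (Del M a y)) x _ :=
    fun x hx => hasP_w ha haM u hx
      ((hu.contDiffAt (hopen.mem_nhds (hmem x hx))).differentiableAt (by norm_num))
      (hur _ (hmem x hx)) (hut _ (hmem x hx))
  refine ⟨?_, ?_, ?_⟩
  · intro x hx μ ν lam
    simp only [F10B_eq]
    exact closed_at ha haM hk _ hx (hw x hx) μ ν lam
  · intro x hx μ
    have hcur : ∀ ν, current M a (F10B M a k α β u) x ν =
        (rho2 a x * Real.sin (x 2))⁻¹ * (-(α * a * Real.sin (x 2) ^ 2 *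
          (u (x 1, x 2) / Real.sqrt (Del M a x)) / Real.cos k) *
          ![Real.cosh (ThB a k α β x) * (x 1 ^ 2 + a ^ 2),
            Real.sinh (ThB a k α β x) * Del M a x, 0, a * Real.cosh (ThB a k α β x)] ν) := by
      intro ν
      have hpd : ∀ l : Fin 4, pd l (fun y => rho2 a y * Real.sin (y 2) *
          ∑ i : Fin 4, ∑ j : Fin 4, (kerr M a y)⁻¹ ν i * (kerr M a y)⁻¹ l j *
            F10B M a k α β u y i j) x
          = pd l (fun y => Hm M a k α β
            (fun y => u (y 1, y 2) / Real.sqrt (Del M a y)) y ν l) x := by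
        intro l
        unfold pd
        rw [Filter.EventuallyEq.fderiv_eq]
        filter_upwards [(kerrExt_isOpen M a).mem_nhds hx] with y hy
        simp only [F10B_eq]
        exact raise ha haM k α β _ hy ν l
      rw [current, Finset.sum_congr rfl fun l _ => hpd l, div_at ha haM hk _ hx (hw x hx) ν]
    have e1 : rho2 a x = x 1 ^ 2 + a ^ 2 * (1 - Real.sin (x 2) ^ 2) := by
      rw [rho2, Real.cos_sq']
    simp only [hcur, Fin.sum_univ_four, F10B_eq]
    generalize (rho2 a x * Real.sin (x 2))⁻¹ = c1
    fin_cases μ <;> simp [Fm] <;> (try rw [e1]) <;> ring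
  · intro x hx
    obtain ⟨h1, h2, h3⟩ := kerrExt_pos ha haM hx
    rw [fsq_eq ha haM k α β _ hx _ (F10B_eq M a k α β u x), div_pow, Real.sq_sqrt h1.le,
      div_mul_cancel₀ _ h1.ne']
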